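/- (Type II, upper triangular type.) Let R = (R_{ij}) be an upper triangular complex 3×3 matrix, i.e., R21 = R31 = R32 = 0. Then the constant R-deformation H_R of the Poisson bivector H of the subregular classical finite W-algebra of sl3 satisfies the Jacobi identity if and only if R11² = R33², R12·(R11 + R22) = 0, and R23·(R22 + R33) = 0. -/

import Mathlib

open MvPolynomial

/-- The Poisson bivector of the subregular classical finite W-algebra of `sl₃`:
`H¹² = −2u₁`, `H¹³ = u₂²`, `H²³ = −2u₃`, extended skew-symmetrically. -/
noncomputable def Hmat : Matrix (Fin 3) (Fin 3) (MvPolynomial (Fin 3) ℂ) :=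
  !![0, -(2 * X 0), (X 1) ^ 2;
     2 * X 0, 0, -(2 * X 2);
     -((X 1) ^ 2), 2 * X 2, 0]

/-- A `3×3` matrix of polynomials satisfies the Jacobi identity if for all `i j k`,
`Σ_l ( P^{il}·∂P^{jk}/∂u_l + P^{jl}·∂P^{ki}/∂u_l + P^{kl}·∂P^{ij}/∂u_l ) = 0`. -/
def JacobiId (P : Matrix (Fin 3) (Fin 3) (MvPolynomial (Fin 3) ℂ)) : Prop :=
  ∀ i j k : Fin 3,
    ∑ l : Fin 3,
      (P i l * pderiv l (P j k) + P j l * pderiv l (P k i) + P k l * pderiv l (P i j)) = 0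

/-- The constant `R`-deformation of a bivector `P`:
`P_R^{ij} = Σ_k ( R_{ik}·P^{kj} + R_{jk}·P^{ik} )`. -/
noncomputable def Rdef (R : Matrix (Fin 3) (Fin 3) ℂ)
    (P : Matrix (Fin 3) (Fin 3) (MvPolynomial (Fin 3) ℂ)) :
    Matrix (Fin 3) (Fin 3) (MvPolynomial (Fin 3) ℂ) :=
  Matrix.of fun i j => ∑ k : Fin 3, (C (R i k) * P k j + C (R j k) * P i k)

/-- For a skew-symmetric matrix the Jacobi identity reduces to its `(1, 2, 3)` component. -/
theorem jacobiId_iff_of_skew {P : Matrix (Fin 3) (Fin 3) (MvPolynomial (Fin 3) ℂ)}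
    (hd : ∀ i, P i i = 0) (hs : ∀ i j, P j i = -P i j) :
    JacobiId P ↔
      ∑ l : Fin 3,
        (P 0 l * pderiv l (P 1 2) + P 1 l * pderiv l (P 2 0) + P 2 l * pderiv l (P 0 1)) = 0 := by
  refine ⟨fun h => h 0 1 2, fun h i j k => ?_⟩
  have h10 := hs 0 1
  have h20 := hs 0 2
  have h21 := hs 1 2
  simp only [Fin.sum_univ_three, h10, h20, h21, hd, map_neg] at h
  fin_cases i <;> fin_cases j <;> fin_cases k <;>
    simp only [Fin.sum_univ_three, Fin.zero_eta, Fin.mk_one, Fin.reduceFinMk, h10, h20, h21, hd,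
      map_neg, map_zero] <;>
    first
      | ring1
      | linear_combination h
      | linear_combination -h

theorem Hmat_self (i : Fin 3) : Hmat i i = 0 := by
  fin_cases i <;> simp [Hmat]

theorem Hmat_skew (i j : Fin 3) : Hmat j i = -Hmat i j := by
  fin_cases i <;> fin_cases j <;> simp [Hmat]

/-- The constant deformation of a skew-symmetric matrix is skew-symmetric. -/
theorem Rdef_skew (R : Matrix (Fin 3) (Fin 3) ℂ)
    {P : Matrix (Fin 3) (Fin 3) (MvPolynomial (Fin 3) ℂ)} (hs : ∀ i j, P j i = -P i j)
    (i j : Fin 3) : Rdef R P j i = -Rdef R P i j := by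
  simp only [Rdef, Matrix.of_apply, ← Finset.sum_neg_distrib]
  refine Finset.sum_congr rfl fun k _ => ?_
  rw [hs i k, hs k j]
  ring

/-- The Jacobiator of the deformation of `Hmat` by an upper triangular matrix. -/
theorem jacobiator_Rdef_Hmat (R : Matrix (Fin 3) (Fin 3) ℂ)
    (h21 : R 1 0 = 0) (h31 : R 2 0 = 0) (h32 : R 2 1 = 0) :
    ∑ l : Fin 3,
      (Rdef R Hmat 0 l * pderiv l (Rdef R Hmat 1 2) + Rdef R Hmat 1 l * pderiv l (Rdef R Hmat 2 0) +
        Rdef R Hmat 2 l * pderiv l (Rdef R Hmat 0 1)) =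
      C (2 * (R 0 0 ^ 2 - R 2 2 ^ 2)) * X 1 ^ 2 - C (4 * (R 0 1 * (R 0 0 + R 1 1))) * X 2 +
        C (4 * (R 1 2 * (R 1 1 + R 2 2))) * (X 1 * X 2) := by
  have two (l : Fin 3) : pderiv l (2 : MvPolynomial (Fin 3) ℂ) = 0 := pderiv_C (a := 2)
  have c2 : (C 2 : MvPolynomial (Fin 3) ℂ) = 2 := rfl
  have c4 : (C 4 : MvPolynomial (Fin 3) ℂ) = 4 := rfl
  simp [Rdef, Hmat, Fin.sum_univ_three, h21, h31, h32, pderiv_X, Pi.single_apply, two, c2, c4]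
  ring

/-- (Type II, upper triangular type.) For an upper triangular matrix `R`
(`R₂₁ = R₃₁ = R₃₂ = 0`), the constant `R`-deformation `H_R` satisfies the Jacobi
identity if and only if `R₁₁² = R₃₃²`, `R₁₂·(R₁₁ + R₂₂) = 0` and `R₂₃·(R₂₂ + R₃₃) = 0`. -/
theorem stmt2 (R : Matrix (Fin 3) (Fin 3) ℂ)
    (h21 : R 1 0 = 0) (h31 : R 2 0 = 0) (h32 : R 2 1 = 0) :
    JacobiId (Rdef R Hmat) ↔
      (R 0 0 ^ 2 = R 2 2 ^ 2 ∧
       R 0 1 * (R 0 0 + R 1 1) = 0 ∧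
       R 1 2 * (R 1 1 + R 2 2) = 0) := by
  have hs := Rdef_skew R Hmat_skew
  rw [jacobiId_iff_of_skew (fun i => self_eq_neg.mp (hs i i)) hs,
    jacobiator_Rdef_Hmat R h21 h31 h32]
  constructor
  · intro h
    have h1 := congrArg (eval ![0, 1, 0]) h
    have h2 := congrArg (eval ![0, 0, 1]) h
    have h3 := congrArg (eval ![0, 1, 1]) h
    simp only [map_add, map_sub, map_mul, map_pow, map_zero, eval_C, eval_X, Matrix.cons_val]
      at h1 h2 h3
    refine ⟨?_, ?_, ?_⟩
    · linear_combination h1 / 2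
    · linear_combination -h2 / 4
    · linear_combination (h3 - h1 - h2) / 4
  · rintro ⟨h1, h2, h3⟩
    simp [h1, h2, h3]
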